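/- Let w ∈ S_n be defined by inclusions. Then there exists a function assigning to each (x,y) ∈ D(w) with r_w(x,y) > 0 a box (p,q) ∈ E(w) with r_w(p,q) > 0, p ≤ x and q ≥ y, lying in the same connected component of D(w) as (x,y), such that I_w equals the ideal of S generated by the variables z_{x,y} for (x,y) ∈ D(w) with r_w(x,y) = 0 together with the minors d_{{p,…,p+r−1} ∪ {x+r}, {y−r} ∪ {q−r+1,…,q}} for (x,y) ∈ D(w) with r := r_w(x,y) > 0 and (p,q) the assigned box. In particular, I_w can be generated by #D(w) = n(n−1)/2 − ℓ(w) elements. -/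

import Mathlib

/-- One-line notation value of a permutation of `Fin n` at a position `k ∈ {1,…,n}`;
junk value `0` outside that range. -/
def pval {n : ℕ} (w : Equiv.Perm (Fin n)) (k : ℕ) : ℕ :=
  if h : 1 ≤ k ∧ k ≤ n then ((w ⟨k - 1, by omega⟩ : Fin n) : ℕ) + 1 else 0

/-- The rank function `r_w(p,q) = #{k ≤ q : w(k) ≥ p}`. -/
def rk {n : ℕ} (w : Equiv.Perm (Fin n)) (p q : ℕ) : ℕ :=
  ((Finset.Icc 1 n).filter fun k => k ≤ q ∧ p ≤ pval w k).card

/-- The Rothe diagram `D(w) = {(p,q) ∈ {1,…,n}² : w(q) < p and w⁻¹(p) > q}`. -/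
def Diagram {n : ℕ} (w : Equiv.Perm (Fin n)) : Set (ℕ × ℕ) :=
  {pq | 1 ≤ pq.1 ∧ pq.1 ≤ n ∧ 1 ≤ pq.2 ∧ pq.2 ≤ n ∧
    pval w pq.2 < pq.1 ∧ pq.2 < pval w.symm pq.1}

/-- The essential set `E(w)`. -/
def EssSet {n : ℕ} (w : Equiv.Perm (Fin n)) : Set (ℕ × ℕ) :=
  {pq | pq ∈ Diagram w ∧ (pq.1, pq.2 + 1) ∉ Diagram w ∧ (pq.1 - 1, pq.2) ∉ Diagram w}

/-- Condition A at `(p,q)`: there is no `k` with `k ≤ q` and `w(k) ≥ p`. -/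
def CondA {n : ℕ} (w : Equiv.Perm (Fin n)) (p q : ℕ) : Prop :=
  ¬ ∃ k, 1 ≤ k ∧ k ≤ n ∧ k ≤ q ∧ p ≤ pval w k

/-- Condition B at `(p,q)`: there is no `k` with `k > q` and `w(k) < p`. -/
def CondB {n : ℕ} (w : Equiv.Perm (Fin n)) (p q : ℕ) : Prop :=
  ¬ ∃ k, 1 ≤ k ∧ k ≤ n ∧ q < k ∧ pval w k < p

/-- `w` is defined by inclusions if every essential set box satisfies Condition A or B. -/
def DefinedByInclusions {n : ℕ} (w : Equiv.Perm (Fin n)) : Prop :=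
  ∀ p q, (p, q) ∈ EssSet w → CondA w p q ∨ CondB w p q

/-- Two boxes of a set `D ⊆ ℕ × ℕ` are adjacent if both lie in `D`, they agree in one
coordinate and differ by `1` in the other. -/
def AdjIn (D : Set (ℕ × ℕ)) (a b : ℕ × ℕ) : Prop :=
  a ∈ D ∧ b ∈ D ∧
    ((a.1 = b.1 ∧ (a.2 = b.2 + 1 ∨ b.2 = a.2 + 1)) ∨
     (a.2 = b.2 ∧ (a.1 = b.1 + 1 ∨ b.1 = a.1 + 1)))

/-- Two boxes lie in the same connected component of `D` if they are joined by a path of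
adjacent boxes of `D`. -/
def SameComponent (D : Set (ℕ × ℕ)) (a b : ℕ × ℕ) : Prop :=
  Relation.ReflTransGen (AdjIn D) a b

/-- Index type for the variables `z_{i,j}` with `1 ≤ j < i ≤ n`. -/
abbrev Idx (n : ℕ) : Type := {p : ℕ × ℕ // 1 ≤ p.2 ∧ p.2 < p.1 ∧ p.1 ≤ n}

/-- The polynomial ring `S = ℚ[z_{i,j} : 1 ≤ j < i ≤ n]`. -/
abbrev PolyS (n : ℕ) : Type := MvPolynomial (Idx n) ℚ

/-- The variable `z_{i,j}` of `S` (junk value `0` when `(i,j)` is out of range). -/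
noncomputable def zvar (n : ℕ) (i j : ℕ) : PolyS n :=
  if h : 1 ≤ j ∧ j < i ∧ i ≤ n then MvPolynomial.X ⟨(i, j), h⟩ else 0

/-- The `(i,j)` entry of the matrix `M`: `1` on the diagonal, `z_{i,j}` below the
diagonal, `0` above it (rows and columns indexed by `{1,…,n}`). -/
noncomputable def Mmat (n : ℕ) (i j : ℕ) : PolyS n :=
  if i = j ∧ 1 ≤ i ∧ i ≤ n then 1 else zvar n i j

/-- The generalized Plücker coordinate `d_{A,B}`: the minor of `M` with rows `A` and
columns `B`, both listed in increasing order (junk value `0` when `#A ≠ #B`). -/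
noncomputable def dminor (n : ℕ) (A B : Finset ℕ) : PolyS n :=
  if h : B.card = A.card then
    Matrix.det (Matrix.of fun i j : Fin A.card =>
      Mmat n ((A.orderIsoOfFin rfl i : ℕ)) ((B.orderIsoOfFin h j : ℕ)))
  else 0

/-- The ideal `I_{(p,q,r)}` generated by all `d_{A,B}` with `A ⊆ {p,…,n}`,
`B ⊆ {1,…,q}` and `#A = #B = r+1`. -/
noncomputable def Iideal (n p q r : ℕ) : Ideal (PolyS n) :=
  Ideal.span {f | ∃ A B : Finset ℕ, A.card = r + 1 ∧ B.card = r + 1 ∧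
    A ⊆ Finset.Icc p n ∧ B ⊆ Finset.Icc 1 q ∧ f = dminor n A B}

/-- The ideal `I_w = Σ_{(p,q) ∈ E(w)} I_{(p,q,r_w(p,q))}`. -/
noncomputable def Iw {n : ℕ} (w : Equiv.Perm (Fin n)) : Ideal (PolyS n) :=
  ⨆ pq ∈ EssSet w, Iideal n pq.1 pq.2 (rk w pq.1 pq.2)
/-- `ℓ(w)`: the number of inversions of `w`. -/
def ell {n : ℕ} (w : Equiv.Perm (Fin n)) : ℕ :=
  (Finset.univ.filter fun ij : Fin n × Fin n => ij.1 < ij.2 ∧ w ij.2 < w ij.1).card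


theorem dminor_eq_det (n : ℕ) {k : ℕ} {A B : Finset ℕ} (hA : A.card = k) (hB : B.card = k)
    {f g : Fin k → ℕ} (hf : StrictMono f) (hg : StrictMono g) (hfA : ∀ i, f i ∈ A)
    (hgB : ∀ i, g i ∈ B) :
    dminor n A B = Matrix.det (Matrix.of fun i j => Mmat n (f i) (g j)) := by
  subst hA
  rw [dminor, dif_pos hB, Finset.orderEmbOfFin_unique rfl hfA hf,
    Finset.orderEmbOfFin_unique hB hgB hg]
  rfl

theorem Mmat_self {n i : ℕ} (h1 : 1 ≤ i) (hn : i ≤ n) : Mmat n i i = 1 := by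
  simp [Mmat, h1, hn]

theorem Mmat_of_lt {n i j : ℕ} (h : i < j) : Mmat n i j = 0 := by
  rw [Mmat, if_neg (by omega), zvar, dif_neg (by omega)]

theorem Mmat_of_gt {n i j : ℕ} (h : j < i) : Mmat n i j = zvar n i j := by
  rw [Mmat, if_neg (by omega)]

/-- `N` is the lower triangular two-sided inverse of `M`, indexed by natural numbers. -/
structure IsInverseMmat (n : ℕ) (N : ℕ → ℕ → PolyS n) : Prop where
  low : ∀ i j, i < j → N i j = 0
  mul_inv : ∀ i ∈ Finset.Ico 1 (n + 1), ∀ j ∈ Finset.Ico 1 (n + 1),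
    ∑ k ∈ Finset.Ico 1 (n + 1), Mmat n i k * N k j = if i = j then 1 else 0
  inv_mul : ∀ i ∈ Finset.Ico 1 (n + 1), ∀ j ∈ Finset.Ico 1 (n + 1),
    ∑ k ∈ Finset.Ico 1 (n + 1), N i k * Mmat n k j = if i = j then 1 else 0

theorem exists_isInverseMmat (n : ℕ) : ∃ N : ℕ → ℕ → PolyS n, IsInverseMmat n N := by
  set A : Matrix (Fin n) (Fin n) (PolyS n) :=
    Matrix.of fun i j => Mmat n (i + 1) (j + 1) with hA
  have hlow : A.BlockTriangular OrderDual.toDual := by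
    intro i j hij
    exact Mmat_of_lt (by simpa using hij)
  have hdet : A.det = 1 := by
    rw [Matrix.det_of_isLowerTriangular A hlow]
    exact Finset.prod_eq_one fun i _ => Mmat_self (by omega) (by omega)
  have hunit : IsUnit A.det := by rw [hdet]; exact isUnit_one
  have := A.invertibleOfIsUnitDet hunit
  have hlow' : A⁻¹.BlockTriangular OrderDual.toDual :=
    Matrix.blockTriangular_inv_of_blockTriangular hlow
  set N : ℕ → ℕ → PolyS n := fun i j =>
    if h : (1 ≤ i ∧ i ≤ n) ∧ (1 ≤ j ∧ j ≤ n) then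
      A⁻¹ ⟨i - 1, by omega⟩ ⟨j - 1, by omega⟩ else 0 with hN
  have hNA : ∀ i j : Fin n, N (i + 1) (j + 1) = A⁻¹ i j := by
    intro i j
    simp only [hN]
    rw [dif_pos (by omega)]
    rfl
  have hsum : ∀ f : ℕ → PolyS n, ∑ k ∈ Finset.Ico 1 (n + 1), f k = ∑ k : Fin n, f (k + 1) := by
    intro f
    rw [Finset.sum_Ico_eq_sum_range, Finset.sum_range]
    simp [add_comm]
  have hfin : ∀ i ∈ Finset.Ico 1 (n + 1), ∃ i' : Fin n, i = i' + 1 := by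
    intro i hi
    rw [Finset.mem_Ico] at hi
    exact ⟨⟨i - 1, by omega⟩, by simp; omega⟩
  have hMN : ∀ i ∈ Finset.Ico 1 (n + 1), ∀ j ∈ Finset.Ico 1 (n + 1),
      ∑ k ∈ Finset.Ico 1 (n + 1), Mmat n i k * N k j = if i = j then 1 else 0 := by
    intro i hi j hj
    obtain ⟨i, rfl⟩ := hfin i hi
    obtain ⟨j, rfl⟩ := hfin j hj
    have := congrFun (congrFun (Matrix.mul_nonsing_inv A hunit) i) j
    rw [Matrix.mul_apply, Matrix.one_apply] at this
    simp only [hsum, hNA, Nat.add_right_cancel_iff, Fin.val_inj]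
    exact this
  have hNM : ∀ i ∈ Finset.Ico 1 (n + 1), ∀ j ∈ Finset.Ico 1 (n + 1),
      ∑ k ∈ Finset.Ico 1 (n + 1), N i k * Mmat n k j = if i = j then 1 else 0 := by
    intro i hi j hj
    obtain ⟨i, rfl⟩ := hfin i hi
    obtain ⟨j, rfl⟩ := hfin j hj
    have := congrFun (congrFun (Matrix.nonsing_inv_mul A hunit) i) j
    rw [Matrix.mul_apply, Matrix.one_apply] at this
    simp only [hsum, hNA, Nat.add_right_cancel_iff, Fin.val_inj]
    exact this
  have hlowN : ∀ i j, i < j → N i j = 0 := by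
    intro i j hij
    simp only [hN]
    split_ifs with h
    · exact hlow' (by simp [Fin.lt_def]; omega)
    · rfl
  exact ⟨N, hlowN, hMN, hNM⟩

/-- The columns of `M` left of `p`, in rows from `p` on, are combinations of the columns
`p,…,q` up to a correction governed by the block of `M⁻¹` in rows `> q` and columns `< p`. -/
theorem Mmat_column_relation {n : ℕ} {N : ℕ → ℕ → PolyS n} (hN : IsInverseMmat n N)
    {p q i b : ℕ} (hb : 1 ≤ b) (hbp : b < p) (hpq : p ≤ q + 1) (hqn : q ≤ n) (hpi : p ≤ i)
    (hin : i ≤ n) :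
    Mmat n i b
      + ∑ j ∈ Finset.Ico p (q + 1), Mmat n i j * ∑ c ∈ Finset.Ico 1 p, N j c * Mmat n c b
      + ∑ j ∈ Finset.Ico (q + 1) (n + 1), Mmat n i j *
          ∑ c ∈ Finset.Ico 1 p, N j c * Mmat n c b = 0 := by
  have hG : ∀ j ∈ Finset.Ico 1 p,
      ∑ c ∈ Finset.Ico 1 p, N j c * Mmat n c b = if j = b then 1 else 0 := by
    intro j hj
    rw [Finset.mem_Ico] at hj
    rw [← hN.inv_mul j (by simp; omega) b (by simp; omega)]
    refine Finset.sum_subset (Finset.Ico_subset_Ico_right (by omega)) fun c _ hc => ?_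
    rw [Finset.mem_Ico] at *
    rw [hN.low j c (by omega), zero_mul]
  have hfirst : Mmat n i b = ∑ j ∈ Finset.Ico 1 p, Mmat n i j *
      ∑ c ∈ Finset.Ico 1 p, N j c * Mmat n c b := by
    rw [Finset.sum_congr rfl fun j hj => by rw [hG j hj]]
    simp [hb, hbp]
  rw [hfirst, Finset.sum_Ico_consecutive _ (by omega) hpq,
    Finset.sum_Ico_consecutive _ (by omega) (by omega)]
  simp_rw [Finset.mul_sum]
  rw [Finset.sum_comm]
  refine Finset.sum_eq_zero fun c hc => ?_
  rw [Finset.mem_Ico] at hc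
  have h := hN.mul_inv i (by simp; omega) c (by simp; omega)
  rw [if_neg (by omega)] at h
  simp_rw [← mul_assoc]
  rw [← Finset.sum_mul, h, zero_mul]

theorem eq_zero_of_neg_one_pow_mul_neg_eq_zero {R : Type*} [Ring R] {k : ℕ} {a : R}
    (h : (-1) ^ k * -a = 0) : a = 0 :=
  neg_eq_zero.1 ((isUnit_one.neg.pow k).mul_right_eq_zero.1 h)

theorem det_eq_zero_of_factor {R : Type*} [CommRing R] {r : ℕ}
    (T : Matrix (Fin (r + 1)) (Fin (r + 1)) R) (U : Fin (r + 1) → ℕ → R)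
    (V : ℕ → Fin (r + 1) → R) (h : ∀ i j, T i j = ∑ l ∈ Finset.range r, U i l * V l j) :
    T.det = 0 := by
  have hT : T = Matrix.of (fun (i l : Fin (r + 1)) => if (l : ℕ) < r then U i l else 0) *
      Matrix.of (fun (l j : Fin (r + 1)) => V l j) := by
    ext i j
    rw [h, Matrix.mul_apply, Fin.sum_univ_castSucc, Finset.sum_range]
    simp
  rw [hT, Matrix.det_mul, Matrix.det_eq_zero_of_column_eq_zero (Fin.last r), zero_mul]
  simp

/-- If `M⁻¹` has entries in `J` in rows `> q` and columns `< p`, then `J` contains the minors of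
size larger than `q - p + 1` of the block of `M` in rows `≥ p` and columns `≤ q`. -/
theorem dminor_mem_of_inverse_block {n : ℕ} {N : ℕ → ℕ → PolyS n}
    (hN : IsInverseMmat n N)
    {J : Ideal (PolyS n)} {p q r : ℕ} (hr : r + p = q + 1) (hqn : q ≤ n)
    (hJ : ∀ a c, q < a → a ≤ n → 1 ≤ c → c < p → N a c ∈ J)
    {A B : Finset ℕ} (hA : A.card = r + 1) (hB : B.card = r + 1)
    (hAp : A ⊆ Finset.Icc p n) (hBq : B ⊆ Finset.Icc 1 q) : dminor n A B ∈ J := by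
  rw [dminor_eq_det n hA hB (A.orderEmbOfFin hA).strictMono (B.orderEmbOfFin hB).strictMono
    (A.orderEmbOfFin_mem hA) (B.orderEmbOfFin_mem hB), ← Ideal.Quotient.eq_zero_iff_mem,
    RingHom.map_det]
  have hcol : ∀ b, 1 ≤ b → b ≤ q → ∃ V : ℕ → PolyS n ⧸ J, ∀ i, p ≤ i → i ≤ n →
      Ideal.Quotient.mk J (Mmat n i b) =
        ∑ l ∈ Finset.range r, Ideal.Quotient.mk J (Mmat n i (p + l)) * V l := by
    intro b hb hbq
    rcases lt_or_ge b p with hbp | hbp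
    · refine ⟨fun l => -Ideal.Quotient.mk J (∑ c ∈ Finset.Ico 1 p, N (p + l) c * Mmat n c b),
        fun i hpi hin => ?_⟩
      have h := congrArg (Ideal.Quotient.mk J)
        (Mmat_column_relation hN hb hbp (by omega) hqn hpi hin)
      have hz : Ideal.Quotient.mk J (∑ j ∈ Finset.Ico (q + 1) (n + 1), Mmat n i j *
          ∑ c ∈ Finset.Ico 1 p, N j c * Mmat n c b) = 0 := by
        rw [Ideal.Quotient.eq_zero_iff_mem]
        refine Ideal.sum_mem _ fun j hj => Ideal.mul_mem_left _ _ <|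
          Ideal.sum_mem _ fun c hc => Ideal.mul_mem_right _ _ ?_
        rw [Finset.mem_Ico] at hj hc
        exact hJ j c (by omega) (by omega) hc.1 hc.2
      rw [map_add, hz, add_zero, map_add, map_zero] at h
      rw [eq_neg_of_add_eq_zero_left h, Finset.sum_Ico_eq_sum_range, show q + 1 - p = r by omega,
        map_sum, ← Finset.sum_neg_distrib]
      exact Finset.sum_congr rfl fun l _ => by rw [map_mul]; ring
    · refine ⟨fun l => if l = b - p then 1 else 0, fun i _ _ => ?_⟩
      simp [show b - p < r by omega, show p + (b - p) = b by omega]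
  have hmemB : ∀ j, 1 ≤ B.orderEmbOfFin hB j ∧ B.orderEmbOfFin hB j ≤ q := fun j =>
    Finset.mem_Icc.1 (hBq (B.orderEmbOfFin_mem hB j))
  choose V hV using fun j => hcol (B.orderEmbOfFin hB j) (hmemB j).1 (hmemB j).2
  refine det_eq_zero_of_factor _
    (fun i l => Ideal.Quotient.mk J (Mmat n (A.orderEmbOfFin hA i) (p + l))) (fun l j => V j l)
    fun i j => ?_
  have hmemA := Finset.mem_Icc.1 (hAp (A.orderEmbOfFin_mem hA i))
  exact hV j _ hmemA.1 hmemA.2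

/-- Modulo the entries of `M⁻¹` weakly north-east of `(x, y)` in rows `> q` and columns `< p`, the
bordered minor on `p,…,q` with extra row `x` and extra column `y` agrees with the entry `(x, y)`
of `M⁻¹` up to sign. -/
theorem inverse_mem_of_bordered_dminor_mem {n : ℕ} {N : ℕ → ℕ → PolyS n}
    (hN : IsInverseMmat n N)
    {J : Ideal (PolyS n)} {p q r x y : ℕ} (hr : r + p = q + 1) (hqx : q < x) (hxn : x ≤ n)
    (hy : 1 ≤ y) (hyp : y < p)
    (hJ : ∀ a c, q < a → a ≤ x → y ≤ c → c < p → (a, c) ≠ (x, y) → N a c ∈ J)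
    (hd : dminor n (Finset.Icc p q ∪ {x}) ({y} ∪ Finset.Icc p q) ∈ J) : N x y ∈ J := by
  set π := Ideal.Quotient.mk J with hπ
  set f : Fin (r + 1) → ℕ := fun i => if (i : ℕ) < r then p + i else x with hf
  set g : Fin (r + 1) → ℕ := Fin.cons y fun j => p + j with hg
  have hcardA : (Finset.Icc p q ∪ {x}).card = r + 1 := by
    rw [Finset.card_union_of_disjoint (by simp; omega)]
    simp; omega
  have hcardB : ({y} ∪ Finset.Icc p q).card = r + 1 := by
    rw [Finset.card_union_of_disjoint (by simp; omega)]
    simp; omega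
  have hfmono : StrictMono f := by
    intro i j hij
    rw [Fin.lt_def] at hij
    simp only [hf]
    split_ifs <;> omega
  have hgmono : StrictMono g := by
    intro i j hij
    induction j using Fin.cases with
    | zero => exact absurd hij (Fin.not_lt_zero i)
    | succ j =>
      induction i using Fin.cases with
      | zero => simp [hg]; omega
      | succ i => simpa [hg] using hij
  have hfA : ∀ i, f i ∈ Finset.Icc p q ∪ {x} := by
    intro i
    simp only [hf, Finset.mem_union, Finset.mem_Icc, Finset.mem_singleton]
    split_ifs <;> omega
  have hgB : ∀ j, g j ∈ {y} ∪ Finset.Icc p q := by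
    intro j
    induction j using Fin.cases with
    | zero => simp [hg]
    | succ j => simp [hg]; omega
  rw [dminor_eq_det n hcardA hcardB hfmono hgmono hfA hgB, ← Ideal.Quotient.eq_zero_iff_mem,
    RingHom.map_det] at hd
  set T := (RingHom.mapMatrix π) (Matrix.of fun i j => Mmat n (f i) (g j)) with hT
  have hcol : ∀ i, ∑ j, (Fin.cons 1 fun l : Fin r =>
      π (∑ c ∈ Finset.Ico 1 p, N (p + l) c * Mmat n c y) : Fin (r + 1) → PolyS n ⧸ J) j • T i j
        = if i = Fin.last r then -π (N x y) else 0 := by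
    intro i
    have hpf : p ≤ f i := by simp only [hf]; split_ifs <;> omega
    have hfn : f i ≤ n := by simp only [hf]; split_ifs <;> omega
    have h := congrArg π
      (Mmat_column_relation hN hy hyp (by omega) (by omega : q ≤ n) hpf hfn)
    have htail : π (∑ j ∈ Finset.Ico (q + 1) (n + 1), Mmat n (f i) j *
        ∑ c ∈ Finset.Ico 1 p, N j c * Mmat n c y) = if i = Fin.last r then π (N x y) else 0 := by
      split_ifs with hi
      · have hfx : f i = x := by simp [hf, hi]
        rw [hfx, hπ, Ideal.Quotient.eq, ← Finset.sum_sdiff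
          (Finset.singleton_subset_iff.2 (by simp; omega : x ∈ Finset.Ico (q + 1) (n + 1))),
          Finset.sum_singleton, Mmat_self (by omega) hxn, one_mul,
          ← Finset.sum_sdiff
          (Finset.singleton_subset_iff.2 (by simp; omega : y ∈ Finset.Ico 1 p)),
          Finset.sum_singleton,
          Mmat_self hy (by omega), mul_one, ← add_assoc, add_sub_cancel_right]
        refine J.add_mem (J.sum_mem fun j hj => ?_) (J.sum_mem fun c hc => ?_)
        · simp only [Finset.mem_sdiff, Finset.mem_Ico, Finset.mem_singleton] at hj
          rcases lt_or_gt_of_ne hj.2 with hjx | hjx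
          · refine J.mul_mem_left _ (J.sum_mem fun c hc => ?_)
            rw [Finset.mem_Ico] at hc
            rcases lt_or_ge c y with hcy | hcy
            · rw [Mmat_of_lt hcy, mul_zero]; exact J.zero_mem
            · exact J.mul_mem_right _ (hJ j c (by omega) hjx.le hcy hc.2 (by simp; omega))
          · rw [Mmat_of_lt hjx, zero_mul]; exact J.zero_mem
        · simp only [Finset.mem_sdiff, Finset.mem_Ico, Finset.mem_singleton] at hc
          rcases lt_or_gt_of_ne hc.2 with hcy | hcy
          · rw [Mmat_of_lt hcy, mul_zero]; exact J.zero_mem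
          · exact J.mul_mem_right _ (hJ x c hqx le_rfl hcy.le hc.1.2 (by simp; omega))
      · have hir : (i : ℕ) < r := by
          have := i.2
          have : (i : ℕ) ≠ r := fun h => hi (Fin.ext h)
          omega
        rw [Finset.sum_eq_zero, map_zero]
        intro j hj
        rw [Finset.mem_Ico] at hj
        rw [Mmat_of_lt (by simp only [hf, if_pos hir]; omega), zero_mul]
    rw [map_add, htail, map_add, map_zero, Finset.sum_Ico_eq_sum_range,
      show q + 1 - p = r by omega, Finset.sum_range] at h
    rw [Fin.sum_univ_succ]
    simp only [Fin.cons_zero, Fin.cons_succ, smul_eq_mul, one_mul, hT, RingHom.mapMatrix_apply,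
      Matrix.map_apply, Matrix.of_apply, hg]
    rw [map_sum] at h
    simp only [map_mul π (Mmat n (f i) _)] at h
    rw [Finset.sum_congr rfl fun l _ => mul_comm _ _, eq_neg_of_add_eq_zero_left h]
    split_ifs <;> simp
  have hdet := Matrix.det_updateCol_sum T 0 (Fin.cons 1 fun l : Fin r =>
      π (∑ c ∈ Finset.Ico 1 p, N (p + l) c * Mmat n c y))
  rw [hd, smul_zero, Matrix.det_succ_column_zero, Finset.sum_eq_single (Fin.last r)] at hdet
  · rw [Matrix.updateCol_self, hcol, if_pos rfl] at hdet
    have hblock : ((T.updateCol 0 fun k => ∑ i, (Fin.cons 1 fun l : Fin r =>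
        π (∑ c ∈ Finset.Ico 1 p, N (p + l) c * Mmat n c y) : Fin (r + 1) → PolyS n ⧸ J) i •
          T k i).submatrix (Fin.last r).succAbove Fin.succ).det = 1 := by
      rw [Matrix.det_of_isLowerTriangular _ ?_]
      · refine Finset.prod_eq_one fun i _ => ?_
        simp [hT, hf, hg]
        rw [Mmat_self (by omega) (by omega), map_one]
      · intro i j hij
        have hij' : i < j := by simpa using hij
        simp [hT, hf, hg]
        rw [Mmat_of_lt (by omega), map_zero]
    rw [hblock, mul_one] at hdet
    exact Ideal.Quotient.eq_zero_iff_mem.1 (eq_zero_of_neg_one_pow_mul_neg_eq_zero hdet)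
  · intro i _ hi
    rw [Matrix.updateCol_self, hcol, if_neg hi, mul_zero, zero_mul]
  · simp

section Combinatorics

variable {n : ℕ} (w : Equiv.Perm (Fin n))

theorem pval_pos {k : ℕ} (h1 : 1 ≤ k) (hn : k ≤ n) : 1 ≤ pval w k := by
  rw [pval, dif_pos ⟨h1, hn⟩]
  omega

theorem pval_le (k : ℕ) : pval w k ≤ n := by
  rw [pval]
  split_ifs <;> omega

theorem pval_val_add_one (i : Fin n) : pval w (i + 1) = w i + 1 := by
  rw [pval, dif_pos (by omega)]
  rfl

theorem pval_symm_pval {k : ℕ} (h1 : 1 ≤ k) (hn : k ≤ n) : pval w.symm (pval w k) = k := by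
  simp only [pval, dif_pos (And.intro h1 hn)]
  rw [dif_pos (by omega)]
  simp
  omega

theorem pval_pval_symm {k : ℕ} (h1 : 1 ≤ k) (hn : k ≤ n) : pval w (pval w.symm k) = k :=
  pval_symm_pval w.symm h1 hn

theorem pval_injOn : Set.InjOn (pval w) (Set.Icc 1 n) := fun a ha b hb h => by
  rw [← pval_symm_pval w ha.1 ha.2, h, pval_symm_pval w hb.1 hb.2]

theorem condA_iff_rk_eq_zero {p q : ℕ} : CondA w p q ↔ rk w p q = 0 := by
  rw [CondA, rk, Finset.card_eq_zero, Finset.filter_eq_empty_iff]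
  simp only [Finset.mem_Icc, not_exists]
  exact forall_congr' fun k => by tauto

theorem succ_le_rk_add {p q : ℕ} (hp : 1 ≤ p) (hq : q ≤ n) : q + 1 ≤ rk w p q + p := by
  have hsmall : ((Finset.Icc 1 q).filter fun k => pval w k < p).card ≤ p - 1 := by
    rw [← Finset.card_image_of_injOn (f := pval w)]
    · refine (Finset.card_le_card (t := Finset.Icc 1 (p - 1)) ?_).trans (by simp)
      intro v hv
      simp only [Finset.mem_image, Finset.mem_filter, Finset.mem_Icc] at hv ⊢
      obtain ⟨k, hk, rfl⟩ := hv
      have := pval_pos w hk.1.1 (by omega)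
      omega
    · refine (pval_injOn w).mono fun k hk => ?_
      simp only [Finset.coe_filter, Finset.mem_Icc, Set.mem_ofPred_eq, Set.mem_Icc] at hk ⊢
      omega
  have hbig : ((Finset.Icc 1 q).filter fun k => ¬ pval w k < p).card ≤ rk w p q := by
    refine Finset.card_le_card fun k hk => ?_
    simp only [Finset.mem_filter, Finset.mem_Icc] at hk ⊢
    omega
  have := Finset.card_filter_add_card_filter_not (s := Finset.Icc 1 q) fun k => pval w k < p
  rw [Nat.card_Icc] at this
  omega

theorem rk_add_eq_of_condB {p q : ℕ} (hp : 1 ≤ p) (hpn : p ≤ n) (hq : q ≤ n)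
    (h : CondB w p q) : rk w p q + p = q + 1 := by
  have hdisj : Disjoint ((Finset.Icc 1 n).filter fun k => k ≤ q ∧ p ≤ pval w k)
      (Finset.Ioc q n) := by
    rw [Finset.disjoint_left]
    intro k hk hk'
    simp only [Finset.mem_filter, Finset.mem_Ioc] at hk hk'
    omega
  have hle : rk w p q + (n - q) ≤ n + 1 - p := by
    rw [rk, ← Nat.card_Ioc, ← Finset.card_union_of_disjoint hdisj,
      ← Finset.card_image_of_injOn (f := pval w), ← Nat.card_Icc]
    · refine Finset.card_le_card fun v hv => ?_
      simp only [Finset.mem_image, Finset.mem_union, Finset.mem_filter, Finset.mem_Ioc] at hv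
      obtain ⟨k, hk, rfl⟩ := hv
      rw [Finset.mem_Icc]
      refine ⟨?_, pval_le w k⟩
      rcases hk with hk | hk
      · exact hk.2.2
      · by_contra hlt
        exact h ⟨k, by omega, hk.2, hk.1, by omega⟩
    · refine (pval_injOn w).mono fun k hk => ?_
      simp only [Finset.coe_union, Finset.coe_filter, Finset.mem_Icc, Finset.coe_Ioc,
        Set.mem_union, Set.mem_ofPred_eq, Set.mem_Ioc, Set.mem_Icc] at hk ⊢
      omega
  have := succ_le_rk_add w hp hq
  omega

theorem sub_add_rk_le_of_rows {p q a k : ℕ} (ha : 1 ≤ a) (hpa : p ≤ a) (hak : a ≤ k)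
    (hk : k ≤ n + 1) (h : ∀ j, a ≤ j → j < k → pval w.symm j ≤ q) :
    k - a + rk w k q ≤ rk w p q := by
  have hcard : ((Finset.Ico a k).image (pval w.symm)).card = k - a := by
    rw [Finset.card_image_of_injOn, Nat.card_Ico]
    refine (pval_injOn w.symm).mono fun j hj => ?_
    simp only [Finset.coe_Ico, Set.mem_Ico, Set.mem_Icc] at hj ⊢
    omega
  rw [← hcard, rk, rk, ← Finset.card_union_of_disjoint]
  · refine Finset.card_le_card fun j hj => ?_
    simp only [Finset.mem_union, Finset.mem_image, Finset.mem_Ico, Finset.mem_filter,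
      Finset.mem_Icc] at hj ⊢
    rcases hj with ⟨i, hi, rfl⟩ | hj
    · rw [pval_pval_symm w (by omega) (by omega)]
      exact ⟨⟨pval_pos _ (by omega) (by omega), pval_le _ _⟩, h i hi.1 hi.2, by omega⟩
    · omega
  · rw [Finset.disjoint_left]
    intro j hj hj'
    simp only [Finset.mem_image, Finset.mem_Ico, Finset.mem_filter] at hj hj'
    obtain ⟨i, hi, rfl⟩ := hj
    rw [pval_pval_symm w (by omega) (by omega)] at hj'
    omega

theorem sub_add_rk_le_of_columns {p q b k : ℕ} (hkb : k ≤ b) (hbq : b ≤ q) (hqn : q ≤ n)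
    (h : ∀ j, k < j → j ≤ b → p ≤ pval w j) : b - k + rk w p k ≤ rk w p q := by
  rw [← Nat.card_Ioc, rk, rk, ← Finset.card_union_of_disjoint]
  · refine Finset.card_le_card fun j hj => ?_
    simp only [Finset.mem_union, Finset.mem_Ioc, Finset.mem_filter, Finset.mem_Icc] at hj ⊢
    rcases hj with hj | hj
    · exact ⟨by omega, by omega, h j hj.1 hj.2⟩
    · omega
  · rw [Finset.disjoint_left]
    intro j hj hj'
    simp only [Finset.mem_Ioc, Finset.mem_filter] at hj hj'
    omega

variable {w}

theorem rk_succ_right {p q : ℕ} (h : pval w (q + 1) < p) : rk w p (q + 1) = rk w p q := by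
  rw [rk, rk]
  congr 1
  refine Finset.filter_congr fun k _ => ⟨fun hk => ⟨?_, hk.2⟩, fun hk => ⟨by omega, hk.2⟩⟩
  rcases Nat.lt_or_ge q k with hlt | hle
  · obtain rfl : k = q + 1 := by omega
    omega
  · exact hle

theorem rk_pred_left {p q : ℕ} (hp : 1 ≤ p) (h : q < pval w.symm (p - 1)) :
    rk w (p - 1) q = rk w p q := by
  rw [rk, rk]
  congr 1
  refine Finset.filter_congr fun k hk' => ⟨fun hk => ⟨hk.1, ?_⟩, fun hk => ⟨hk.1, by omega⟩⟩
  rw [Finset.mem_Icc] at hk'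
  by_contra hlt
  have hpk : pval w k = p - 1 := by omega
  rw [← hpk, pval_symm_pval w hk'.1 hk'.2] at h
  omega

/-- Every box of the diagram is joined to an essential box weakly north-east of it, by a path that
does not cross a row or column blocked by a dot of the permutation. -/
theorem exists_essSet_northeast {x y : ℕ} (h : (x, y) ∈ Diagram w) :
    ∃ p q, (p, q) ∈ EssSet w ∧ p ≤ x ∧ y ≤ q ∧ SameComponent (Diagram w) (x, y) (p, q) ∧
      rk w p q = rk w x y ∧ (∀ j < x, pval w.symm j ≤ y → j < p) ∧
      (∀ c > y, x ≤ pval w c → q < c) := by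
  induction hm : x + (n - y) using Nat.strong_induction_on generalizing x y with
  | _ m ih =>
    have hD := h
    obtain ⟨h1, h2, h3, h4, h5, h6⟩ := hD
    simp only at h1 h2 h3 h4 h5 h6
    by_cases hright : (x, y + 1) ∈ Diagram w
    · have hR := hright
      obtain ⟨-, -, -, g4, g5, -⟩ := hR
      simp only at g4 g5
      obtain ⟨p, q, hE, hp, hq, hc, hr, hrow, hcol⟩ := ih _ (by omega) hright rfl
      refine ⟨p, q, hE, hp, by omega,
        .head ⟨h, hright, .inl ⟨rfl, .inr rfl⟩⟩ hc, by rw [hr, rk_succ_right g5],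
        fun j hj hjy => hrow j hj (by omega), fun c hc hxc => ?_⟩
      have : c ≠ y + 1 := by rintro rfl; omega
      exact hcol c (by omega) hxc
    by_cases hup : (x - 1, y) ∈ Diagram w
    · have hU := hup
      obtain ⟨g1, -, -, -, -, g6⟩ := hU
      simp only at g1 g6
      obtain ⟨p, q, hE, hp, hq, hc, hr, hrow, hcol⟩ := ih _ (by omega) hup rfl
      refine ⟨p, q, hE, by omega, hq,
        .head ⟨h, hup, .inr ⟨rfl, .inl (by simp only; omega)⟩⟩ hc, by rw [hr, rk_pred_left h1 g6],
        fun j hj hjy => ?_, fun c hc hxc => hcol c hc (by omega)⟩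
      have : j ≠ x - 1 := by rintro rfl; omega
      exact hrow j (by omega) hjy
    · exact ⟨x, y, ⟨h, hright, hup⟩, le_rfl, le_rfl, .refl, rfl, fun _ h _ => h, fun _ h _ => h⟩

theorem mem_diagram_of_rk_eq_zero {p q x y : ℕ} (hE : (p, q) ∈ EssSet w) (h0 : rk w p q = 0)
    (hpx : p ≤ x) (hxn : x ≤ n) (hy : 1 ≤ y) (hyq : y ≤ q) :
    (x, y) ∈ Diagram w ∧ rk w x y = 0 := by
  obtain ⟨⟨h1, h2, h3, h4, h5, h6⟩, -⟩ := hE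
  simp only at h1 h2 h3 h4 h5 h6
  rw [← condA_iff_rk_eq_zero] at h0
  refine ⟨⟨by simp only; omega, hxn, hy, by simp only; omega, ?_, ?_⟩, ?_⟩
  · by_contra hlt
    exact h0 ⟨y, hy, by omega, hyq, by simp only at hlt; omega⟩
  · by_contra hlt
    refine h0 ⟨pval w.symm x, pval_pos _ (by omega) hxn, pval_le _ _, ?_, ?_⟩
    · simp only at hlt; omega
    · rw [pval_pval_symm w (by omega) hxn]; exact hpx
  · rw [← condA_iff_rk_eq_zero]
    rintro ⟨k, hk1, hkn, hky, hxk⟩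
    exact h0 ⟨k, hk1, hkn, by omega, by omega⟩

theorem lt_of_mem_diagram_of_rk_eq_zero {x y : ℕ} (h : (x, y) ∈ Diagram w)
    (h0 : rk w x y = 0) : y < x := by
  have := succ_le_rk_add w h.1 h.2.2.2.1
  simp only at this
  omega

/-- For an essential box `(p, q)` satisfying Condition B and a position `(x, y)` with `q < x` and
`y < p`: either `(x, y)` comes from a diagram box of the same rank, or it is controlled by a
rank-zero essential box, or by an essential box of smaller positive rank satisfying Condition B. -/
theorem border_cases (hw : DefinedByInclusions w) {p q x y : ℕ} (hE : (p, q) ∈ EssSet w)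
    (hB : CondB w p q) (hqx : q < x) (hxn : x ≤ n) (hy : 1 ≤ y) (hyp : y < p) :
    ((x - rk w p q, y + rk w p q) ∈ Diagram w ∧
      rk w (x - rk w p q) (y + rk w p q) = rk w p q) ∨
    (∃ p' q', (p', q') ∈ EssSet w ∧ rk w p' q' = 0 ∧ p' ≤ x ∧ q ≤ q') ∨
    (∃ p' q', (p', q') ∈ EssSet w ∧ rk w p' q' = 0 ∧ p' ≤ p ∧ y ≤ q') ∨
    ∃ p' q', (p', q') ∈ EssSet w ∧ CondB w p' q' ∧ 0 < rk w p' q' ∧ rk w p' q' < rk w p q ∧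
      q' < x ∧ y < p' := by
  obtain ⟨⟨h1, h2, h3, h4, h5, h6⟩, -⟩ := id hE
  simp only at h1 h2 h3 h4 h5 h6
  have hr := rk_add_eq_of_condB w h1 h2 h4 hB
  obtain ⟨r, hrdef⟩ : ∃ r, r = rk w p q := ⟨_, rfl⟩
  rw [← hrdef] at hr ⊢
  by_cases hrow : ∃ b, 1 ≤ b ∧ b ≤ q ∧ p ≤ pval w b ∧ pval w b ≤ x - r
  · obtain ⟨b, hb1, hbq, hpb, hbx⟩ := hrow
    have hsymm := pval_symm_pval w hb1 (by omega : b ≤ n)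
    have han := pval_le w b
    set a := pval w b with ha
    have hex : ∃ k, a ≤ k ∧ (n < k ∨ q < pval w.symm k) := ⟨n + 1, by omega, .inl (by omega)⟩
    classical
    obtain ⟨hak, hk⟩ := Nat.find_spec hex
    have hmin : ∀ j, a ≤ j → j < Nat.find hex → pval w.symm j ≤ q := fun j haj hj => by
      have := Nat.find_min hex hj
      simp only [haj, true_and, not_or] at this
      omega
    have hkn' : Nat.find hex ≤ n + 1 := Nat.find_min' hex ⟨by omega, .inl (by omega)⟩
    set k := Nat.find hex with hkdef
    have hcount := sub_add_rk_le_of_rows w (by omega) hpb hak hkn' hmin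
    rw [← hrdef] at hcount
    have hkn : k ≤ n := by
      by_contra hlt
      omega
    have hqk : q < pval w.symm k := by omega
    have hne : a ≠ k := fun h => by rw [← h, hsymm] at hqk; omega
    have hkD : (k, q) ∈ Diagram w :=
      ⟨by simp only; omega, hkn, h3, h4, by simp only; omega, hqk⟩
    obtain ⟨p', q', hE', hp', hq', -, hr', hblock, -⟩ := exists_essSet_northeast hkD
    have := hblock (k - 1) (by omega) (hmin _ (by omega) (by omega))
    have hpk : p' = k := by omega
    rcases Nat.eq_zero_or_pos (rk w p' q') with h0 | hpos
    · exact .inr (.inl ⟨p', q', hE', h0, by omega, hq'⟩)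
    · have hB' := (hw p' q' hE').resolve_left fun hA => by
        rw [condA_iff_rk_eq_zero] at hA; omega
      have := rk_add_eq_of_condB w hE'.1.1 hE'.1.2.1 hE'.1.2.2.2.1 hB'
      simp only at this
      exact .inr (.inr (.inr ⟨p', q', hE', hB', hpos, by omega, by omega, by omega⟩))
  by_cases hcol : ∃ b, y + r ≤ b ∧ b ≤ q ∧ p ≤ pval w b
  · obtain ⟨b, hyb, hbq, hpb⟩ := hcol
    set k := Nat.findGreatest (fun k => pval w k < p) b with hkdef
    have hkb : k ≤ b := Nat.findGreatest_le b
    have hkp : pval w k < p :=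
      Nat.findGreatest_spec (P := fun k => pval w k < p) (Nat.zero_le b)
        (by simp only [pval]; rw [dif_neg (by omega)]; omega)
    have hmax : ∀ j, k < j → j ≤ b → p ≤ pval w j := fun j hj hjb =>
      not_lt.1 (Nat.findGreatest_is_greatest (P := fun k => pval w k < p) hj hjb)
    have hcount := sub_add_rk_le_of_columns w hkb hbq h4 hmax
    rw [← hrdef] at hcount
    have hne : b ≠ k := fun h => by rw [← h] at hkp; omega
    have hkD : (p, k) ∈ Diagram w :=
      ⟨h1, h2, by simp only; omega, by simp only; omega, hkp, by simp only; omega⟩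
    obtain ⟨p', q', hE', hp', hq', -, hr', -, hblock⟩ := exists_essSet_northeast hkD
    have := hblock (k + 1) (by omega) (hmax _ (by omega) (by omega))
    have hqk : q' = k := by omega
    rcases Nat.eq_zero_or_pos (rk w p' q') with h0 | hpos
    · exact .inr (.inr (.inl ⟨p', q', hE', h0, hp', by omega⟩))
    · have hB' := (hw p' q' hE').resolve_left fun hA => by
        rw [condA_iff_rk_eq_zero] at hA; omega
      have := rk_add_eq_of_condB w hE'.1.1 hE'.1.2.1 (by omega) hB'
      simp only at this
      exact .inr (.inr (.inr ⟨p', q', hE', hB', hpos, by omega, by omega, by omega⟩))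
  · left
    push Not at hrow hcol
    refine ⟨⟨by simp only; omega, by simp only; omega, by simp only; omega, by simp only; omega,
      ?_, ?_⟩, ?_⟩
    · by_contra hlt
      have := hcol (y + r) le_rfl (by omega)
      simp only at hlt
      omega
    · by_contra hlt
      simp only at hlt
      have hpv := pval_pval_symm w (k := x - r) (by omega) (by omega)
      have := hrow (pval w.symm (x - r)) (pval_pos w.symm (by omega) (by omega))
        (by omega) (by rw [hpv]; omega)
      omega
    · refine Eq.trans ?_ hrdef.symm
      rw [rk, rk]
      congr 1
      refine Finset.filter_congr fun k hk => ?_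
      rw [Finset.mem_Icc] at hk
      constructor
      · rintro ⟨hky, hxk⟩
        omega
      · rintro ⟨hkq, hpk⟩
        have := hrow k hk.1 hkq hpk
        refine ⟨?_, by omega⟩
        by_contra hlt
        have := hcol k (by omega) hkq
        omega

theorem ncard_diagram : (Diagram w).ncard = n * (n - 1) / 2 - ell w := by
  classical
  have htotal : (Finset.univ.filter fun ij : Fin n × Fin n => ij.1 < ij.2).card
      = n * (n - 1) / 2 := by
    rw [Finset.card_filter, Fintype.sum_prod_type_right, ← Finset.sum_range_id,
      Finset.sum_range]
    refine Finset.sum_congr rfl fun j _ => ?_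
    rw [← Finset.card_filter]
    rw [← Fin.card_Iio]
    congr 1
    ext
    simp
  have hsplit := Finset.card_filter_add_card_filter_not
    (s := Finset.univ.filter fun ij : Fin n × Fin n => ij.1 < ij.2) fun ij => w ij.2 < w ij.1
  rw [Finset.filter_filter, htotal] at hsplit
  have hD : (Diagram w).ncard = ((Finset.univ.filter fun ij : Fin n × Fin n =>
      ij.1 < ij.2).filter fun ij => ¬ w ij.2 < w ij.1).card := by
    rw [← Set.ncard_coe_finset]
    symm
    refine Set.ncard_congr (fun ij _ => ((w ij.2 : ℕ) + 1, (ij.1 : ℕ) + 1)) ?_ ?_ ?_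
    · rintro ⟨i, j⟩ hij
      simp only [Finset.mem_coe, Finset.mem_filter, Finset.mem_univ, true_and, not_lt] at hij
      have hne : w i ≠ w j := fun h => hij.1.ne (w.injective h)
      have hlt : w i < w j := lt_of_le_of_ne hij.2 hne
      have hij1 := hij.1
      rw [Fin.lt_def] at hlt hij1
      refine ⟨by simp, by simp only; omega, by simp, by simp only; omega, ?_, ?_⟩
      · simp only [pval_val_add_one]
        omega
      · simp only [pval_val_add_one, Equiv.symm_apply_apply]
        omega
    · rintro ⟨i, j⟩ ⟨i', j'⟩ _ _ h
      simpa [Fin.val_inj, and_comm] using h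
    · rintro ⟨x, y⟩ ⟨h1, h2, h3, h4, h5, h6⟩
      simp only at h1 h2 h3 h4 h5 h6
      obtain ⟨x, rfl⟩ : ∃ x' : Fin n, x = x' + 1 := ⟨⟨x - 1, by omega⟩, by simp only; omega⟩
      obtain ⟨y, rfl⟩ : ∃ y' : Fin n, y = y' + 1 := ⟨⟨y - 1, by omega⟩, by simp only; omega⟩
      rw [pval_val_add_one] at h5 h6
      refine ⟨(y, w.symm x), ?_, by simp⟩
      simp only [Finset.mem_coe, Finset.mem_filter, Finset.mem_univ, true_and,
        Equiv.apply_symm_apply, Fin.lt_def]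
      omega
  rw [hD, ell]
  omega

end Combinatorics

section Ideals

variable {n : ℕ} {w : Equiv.Perm (Fin n)}

theorem Mmat_mem_of_rk_eq_zero {J : Ideal (PolyS n)}
    (hz : ∀ x y, (x, y) ∈ Diagram w → rk w x y = 0 → zvar n x y ∈ J) {p q x y : ℕ}
    (hE : (p, q) ∈ EssSet w) (h0 : rk w p q = 0) (hpx : p ≤ x) (hxn : x ≤ n) (hy : 1 ≤ y)
    (hyq : y ≤ q) : Mmat n x y ∈ J := by
  obtain ⟨hD, hr⟩ := mem_diagram_of_rk_eq_zero hE h0 hpx hxn hy hyq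
  rw [Mmat_of_gt (lt_of_mem_diagram_of_rk_eq_zero hD hr)]
  exact hz x y hD hr

/-- An ideal containing the variables of the rank-zero diagram boxes and one bordered minor for
each positive-rank diagram box contains the blocks of `M⁻¹` cut out by the essential boxes
satisfying Condition B. -/
theorem inverse_mem_of_condB (hw : DefinedByInclusions w) {N : ℕ → ℕ → PolyS n}
    (hN : IsInverseMmat n N) {J : Ideal (PolyS n)}
    (hz : ∀ x y, (x, y) ∈ Diagram w → rk w x y = 0 → zvar n x y ∈ J)
    (hd : ∀ x y, (x, y) ∈ Diagram w → 0 < rk w x y → ∃ p q, (p, q) ∈ EssSet w ∧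
      rk w p q = rk w x y ∧ p ≤ x ∧ y ≤ q ∧
      dminor n (Finset.Icc p q ∪ {x + rk w x y}) ({y - rk w x y} ∪ Finset.Icc p q) ∈ J)
    {p q x y : ℕ} (hE : (p, q) ∈ EssSet w) (hB : CondB w p q) (hpos : 0 < rk w p q)
    (hqx : q < x) (hxn : x ≤ n) (hy : 1 ≤ y) (hyp : y < p) : N x y ∈ J := by
  induction hm : x - y using Nat.strong_induction_on generalizing p q x y with
  | _ m ihm =>
  induction hr : rk w p q using Nat.strong_induction_on generalizing p q with
  | _ r ihr =>
  subst hm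
  have hrpq := rk_add_eq_of_condB w hE.1.1 hE.1.2.1 hE.1.2.2.2.1 hB
  simp only [hr] at hrpq
  have hqn : q ≤ n := hE.1.2.2.2.1
  have hp : 1 ≤ p := hE.1.1
  rcases border_cases hw hE hB hqx hxn hy hyp with ⟨hD, hrk⟩ | ⟨p', q', hE', h0, hp', hq'⟩ |
    ⟨p', q', hE', h0, hp', hq'⟩ | ⟨p', q', hE', hB', hpos', hlt, hx, hy'⟩
  · rw [hr] at hD hrk
    obtain ⟨p', q', hE', hr', hp', hq', hmem⟩ := hd _ _ hD (by omega)
    rw [hrk] at hr' hmem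
    have hB' := (hw p' q' hE').resolve_left fun hA => by
      rw [condA_iff_rk_eq_zero] at hA; omega
    have hrpq' := rk_add_eq_of_condB w hE'.1.1 hE'.1.2.1 hE'.1.2.2.2.1 hB'
    simp only [hr'] at hrpq'
    rw [show x - r + r = x by omega, show y + r - r = y by omega] at hmem
    refine inverse_mem_of_bordered_dminor_mem hN hrpq' (by omega) hxn hy (by omega)
      (fun a c hqa hax hyc hcp hne => ?_) hmem
    have : a ≠ x ∨ c ≠ y := by
      by_contra hcon
      push Not at hcon
      exact hne (Prod.ext hcon.1 hcon.2)
    exact ihm (a - c) (by omega) hE' hB' (by omega) hqa (by omega) (by omega) hcp rfl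
  · have h := hN.mul_inv x (by simp; omega) y (by simp; omega)
    rw [if_neg (by omega), Finset.sum_eq_add_sum_sdiff_singleton_of_mem (i := x) (by simp; omega),
      Mmat_self (by omega) hxn, one_mul] at h
    rw [eq_neg_of_add_eq_zero_left h]
    refine J.neg_mem (J.sum_mem fun k hk => ?_)
    simp only [Finset.mem_sdiff, Finset.mem_Ico, Finset.mem_singleton] at hk
    rcases le_or_gt k q with hkq | hqk
    · exact J.mul_mem_right _ (Mmat_mem_of_rk_eq_zero hz hE' h0 hp' hxn hk.1.1 (by omega))
    · rcases lt_or_gt_of_ne hk.2 with hkx | hxk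
      · exact J.mul_mem_left _
          (ihm (k - y) (by omega) hE hB (by omega) hqk (by omega) hy hyp rfl)
      · rw [Mmat_of_lt hxk, zero_mul]
        exact J.zero_mem
  · have h := hN.inv_mul x (by simp; omega) y (by simp; omega)
    rw [if_neg (by omega), Finset.sum_eq_add_sum_sdiff_singleton_of_mem (i := y) (by simp; omega),
      Mmat_self hy (by omega), mul_one] at h
    rw [eq_neg_of_add_eq_zero_left h]
    refine J.neg_mem (J.sum_mem fun k hk => ?_)
    simp only [Finset.mem_sdiff, Finset.mem_Ico, Finset.mem_singleton] at hk
    rcases le_or_gt p k with hpk | hkp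
    · exact J.mul_mem_left _
        (Mmat_mem_of_rk_eq_zero hz hE' h0 (by omega) (by omega) hy hq')
    · rcases lt_or_gt_of_ne hk.2 with hky | hyk
      · rw [Mmat_of_lt hky, mul_zero]
        exact J.zero_mem
      · exact J.mul_mem_right _
          (ihm (x - k) (by omega) hE hB (by omega) hqx hxn (by omega) hkp rfl)
  · exact ihr _ (by omega) hE' hB' hpos' hx hy' rfl

theorem Iw_le (hw : DefinedByInclusions w) {J : Ideal (PolyS n)}
    (hz : ∀ x y, (x, y) ∈ Diagram w → rk w x y = 0 → zvar n x y ∈ J)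
    (hd : ∀ x y, (x, y) ∈ Diagram w → 0 < rk w x y → ∃ p q, (p, q) ∈ EssSet w ∧
      rk w p q = rk w x y ∧ p ≤ x ∧ y ≤ q ∧
      dminor n (Finset.Icc p q ∪ {x + rk w x y}) ({y - rk w x y} ∪ Finset.Icc p q) ∈ J) :
    Iw w ≤ J := by
  obtain ⟨N, hN⟩ := exists_isInverseMmat n
  refine iSup₂_le ?_
  rintro ⟨p, q⟩ hE
  rw [Iideal, Ideal.span_le]
  rintro _ ⟨A, B, hA, hB, hAp, hBq, rfl⟩
  simp only at hA hB hAp hBq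
  rcases Nat.eq_zero_or_pos (rk w p q) with h0 | hpos
  · rw [h0] at hA hB
    rw [dminor_eq_det n hA hB (A.orderEmbOfFin hA).strictMono (B.orderEmbOfFin hB).strictMono
      (A.orderEmbOfFin_mem hA) (B.orderEmbOfFin_mem hB), Matrix.det_fin_one]
    have hmemA := Finset.mem_Icc.1 (hAp (A.orderEmbOfFin_mem hA 0))
    have hmemB := Finset.mem_Icc.1 (hBq (B.orderEmbOfFin_mem hB 0))
    exact Mmat_mem_of_rk_eq_zero hz hE h0 hmemA.1 hmemA.2 hmemB.1 hmemB.2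
  · have hcB := (hw p q hE).resolve_left fun hA => by
      rw [condA_iff_rk_eq_zero] at hA; omega
    exact dminor_mem_of_inverse_block hN
      (rk_add_eq_of_condB w hE.1.1 hE.1.2.1 hE.1.2.2.2.1 hcB) hE.1.2.2.2.1
      (fun a c hqa han hc hcp => inverse_mem_of_condB hw hN hz hd hE hcB hpos hqa han hc hcp)
      hA hB hAp hBq

theorem dminor_mem_Iw {p q : ℕ} (hE : (p, q) ∈ EssSet w) {A B : Finset ℕ}
    (hA : A.card = rk w p q + 1) (hB : B.card = rk w p q + 1) (hAp : A ⊆ Finset.Icc p n)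
    (hBq : B ⊆ Finset.Icc 1 q) : dminor n A B ∈ Iw w :=
  (le_iSup₂ (f := fun pq (_ : pq ∈ EssSet w) => Iideal n pq.1 pq.2 (rk w pq.1 pq.2)) (p, q) hE)
    (Ideal.subset_span ⟨A, B, hA, hB, hAp, hBq, rfl⟩)

theorem zvar_mem_Iw {x y : ℕ} (hD : (x, y) ∈ Diagram w) (h0 : rk w x y = 0) :
    zvar n x y ∈ Iw w := by
  obtain ⟨p, q, hE, hp, hq, -, hr, -⟩ := exists_essSet_northeast hD
  have hdet : dminor n {x} {y} = zvar n x y := by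
    rw [dminor_eq_det n (k := 1) (f := fun _ => x) (g := fun _ => y) (by simp) (by simp)
      (Subsingleton.strictMono _) (Subsingleton.strictMono _) (by simp) (by simp),
      Matrix.det_fin_one, Matrix.of_apply, Mmat_of_gt (lt_of_mem_diagram_of_rk_eq_zero hD h0)]
  rw [← hdet]
  refine dminor_mem_Iw hE (by simp [hr, h0]) (by simp [hr, h0]) ?_ ?_
  · simp only [Finset.singleton_subset_iff, Finset.mem_Icc]
    exact ⟨hp, hD.2.1⟩
  · simp only [Finset.singleton_subset_iff, Finset.mem_Icc]
    exact ⟨hD.2.2.1, hq⟩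

theorem rk_bounds {x y : ℕ} (hD : (x, y) ∈ Diagram w) : x + rk w x y ≤ n ∧ rk w x y < y := by
  obtain ⟨h1, h2, h3, h4, h5, h6⟩ := hD
  simp only at h1 h2 h3 h4 h5 h6
  constructor
  · have hle : rk w x y ≤ (Finset.Ioc x n).card := by
      rw [rk, ← Finset.card_image_of_injOn (f := pval w)]
      · refine Finset.card_le_card fun v hv => ?_
        simp only [Finset.mem_image, Finset.mem_filter, Finset.mem_Icc] at hv
        obtain ⟨k, hk, rfl⟩ := hv
        rw [Finset.mem_Ioc]
        refine ⟨lt_of_le_of_ne hk.2.2 ?_, pval_le w k⟩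
        rintro rfl
        rw [pval_symm_pval w hk.1.1 hk.1.2] at h6
        omega
      · refine (pval_injOn w).mono fun k hk => ?_
        simp only [Finset.coe_filter, Finset.mem_Icc, Set.mem_ofPred_eq, Set.mem_Icc] at hk ⊢
        exact hk.1
    rw [Nat.card_Ioc] at hle
    omega
  · have hle : rk w x y ≤ (Finset.Ico 1 y).card := by
      refine Finset.card_le_card fun k hk => ?_
      simp only [Finset.mem_filter, Finset.mem_Icc, Finset.mem_Ico] at hk ⊢
      have : k ≠ y := by rintro rfl; omega
      omega
    rw [Nat.card_Ico] at hle
    omega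

theorem bordered_dminor_mem_Iw (hw : DefinedByInclusions w) {p q x y : ℕ}
    (hE : (p, q) ∈ EssSet w) (hD : (x, y) ∈ Diagram w) (hr : rk w p q = rk w x y)
    (hpos : 0 < rk w x y) (hpx : p ≤ x) (hyq : y ≤ q) :
    dminor n (Finset.Icc p q ∪ {x + rk w x y}) ({y - rk w x y} ∪ Finset.Icc p q) ∈ Iw w := by
  have hB := (hw p q hE).resolve_left fun hA => by
    rw [condA_iff_rk_eq_zero] at hA; omega
  have hp : 1 ≤ p := hE.1.1
  have hqn : q ≤ n := hE.1.2.2.2.1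
  have hrpq := rk_add_eq_of_condB w hp hE.1.2.1 hqn hB
  have hbounds := rk_bounds hD
  refine dminor_mem_Iw hE ?_ ?_ ?_ ?_
  · rw [Finset.card_union_of_disjoint (by simp; omega)]
    simp; omega
  · rw [Finset.card_union_of_disjoint (by simp; omega)]
    simp; omega
  · intro a ha
    simp only [Finset.mem_union, Finset.mem_Icc, Finset.mem_singleton] at ha ⊢
    omega
  · intro a ha
    simp only [Finset.mem_union, Finset.mem_Icc, Finset.mem_singleton] at ha ⊢
    omega

end Ideals

/-- For `w` defined by inclusions there is a function assigning to each positive-rank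
diagram box `(x,y)` an essential box `(p,q)` of positive rank, weakly NE of `(x,y)` and in
the same connected component of `D(w)`, such that `I_w` is generated by the variables
`z_{x,y}` for rank-`0` diagram boxes together with the minors
`d_{{p,…,p+r−1} ∪ {x+r}, {y−r} ∪ {q−r+1,…,q}}` (with `r = r_w(x,y)`) for positive-rank
diagram boxes.  In particular `I_w` is generated by `#D(w) = n(n−1)/2 − ℓ(w)` elements. -/
theorem Iw_generated_by_diagram_many_elements {n : ℕ} (w : Equiv.Perm (Fin n))
    (hw : DefinedByInclusions w) :
    (∃ φ : ℕ × ℕ → ℕ × ℕ,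
      (∀ xy ∈ Diagram w, 0 < rk w xy.1 xy.2 →
        φ xy ∈ EssSet w ∧ 0 < rk w (φ xy).1 (φ xy).2 ∧
          (φ xy).1 ≤ xy.1 ∧ xy.2 ≤ (φ xy).2 ∧
          SameComponent (Diagram w) xy (φ xy)) ∧
      Iw w = Ideal.span
        ({f | ∃ xy ∈ Diagram w, rk w xy.1 xy.2 = 0 ∧ f = zvar n xy.1 xy.2} ∪
         {f | ∃ xy ∈ Diagram w, 0 < rk w xy.1 xy.2 ∧
            f = dminor n
              (Finset.Icc (φ xy).1 ((φ xy).1 + rk w xy.1 xy.2 - 1) ∪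
                {xy.1 + rk w xy.1 xy.2})
              ({xy.2 - rk w xy.1 xy.2} ∪
                Finset.Icc ((φ xy).2 - rk w xy.1 xy.2 + 1) (φ xy).2)})) ∧
    (Diagram w).ncard = n * (n - 1) / 2 - ell w ∧
    ∃ g : Fin (n * (n - 1) / 2 - ell w) → PolyS n,
      Ideal.span (Set.range g) = Iw w := by
  have hexists : ∀ xy : ℕ × ℕ, ∃ pq : ℕ × ℕ, xy ∈ Diagram w →
      pq ∈ EssSet w ∧ pq.1 ≤ xy.1 ∧ xy.2 ≤ pq.2 ∧ SameComponent (Diagram w) xy pq ∧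
        rk w pq.1 pq.2 = rk w xy.1 xy.2 := by
    rintro ⟨x, y⟩
    by_cases h : (x, y) ∈ Diagram w
    · obtain ⟨p, q, hE, hp, hq, hc, hr, -⟩ := exists_essSet_northeast h
      exact ⟨(p, q), fun _ => ⟨hE, hp, hq, hc, hr⟩⟩
    · exact ⟨(0, 0), fun h' => absurd h' h⟩
  choose φ hφ using hexists
  have hmain : Iw w = Ideal.span
        ({f | ∃ xy ∈ Diagram w, rk w xy.1 xy.2 = 0 ∧ f = zvar n xy.1 xy.2} ∪
         {f | ∃ xy ∈ Diagram w, 0 < rk w xy.1 xy.2 ∧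
            f = dminor n
              (Finset.Icc (φ xy).1 ((φ xy).1 + rk w xy.1 xy.2 - 1) ∪
                {xy.1 + rk w xy.1 xy.2})
              ({xy.2 - rk w xy.1 xy.2} ∪
                Finset.Icc ((φ xy).2 - rk w xy.1 xy.2 + 1) (φ xy).2)}) := by
    have hIcc : ∀ xy ∈ Diagram w, 0 < rk w xy.1 xy.2 →
        (φ xy).1 + rk w xy.1 xy.2 - 1 = (φ xy).2 ∧
          (φ xy).2 - rk w xy.1 xy.2 + 1 = (φ xy).1 := by
      intro xy h hpos
      obtain ⟨hE, -, -, -, hr⟩ := hφ xy h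
      have hB := (hw (φ xy).1 (φ xy).2 hE).resolve_left fun hA => by
        rw [condA_iff_rk_eq_zero] at hA; omega
      have := rk_add_eq_of_condB w hE.1.1 hE.1.2.1 hE.1.2.2.2.1 hB
      have := hE.1.1
      omega
    apply le_antisymm
    · refine Iw_le hw (fun x y h h0 => Ideal.subset_span (.inl ⟨(x, y), h, h0, rfl⟩))
        fun x y h hpos => ?_
      obtain ⟨hE, hp, hq, -, hr⟩ := hφ (x, y) h
      refine ⟨(φ (x, y)).1, (φ (x, y)).2, hE, hr, hp, hq,
        Ideal.subset_span (.inr ⟨(x, y), h, hpos, ?_⟩)⟩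
      obtain ⟨h1, h2⟩ := hIcc (x, y) h hpos
      rw [h1, h2]
    · rw [Ideal.span_le]
      rintro _ (⟨⟨x, y⟩, h, h0, rfl⟩ | ⟨⟨x, y⟩, h, hpos, rfl⟩)
      · exact zvar_mem_Iw h h0
      · obtain ⟨hE, hp, hq, -, hr⟩ := hφ (x, y) h
        obtain ⟨h1, h2⟩ := hIcc (x, y) h hpos
        rw [h1, h2]
        exact bordered_dminor_mem_Iw hw hE h hr hpos hp hq
  refine ⟨⟨φ, fun xy h hpos => ?_, hmain⟩, ncard_diagram, ?_⟩
  · obtain ⟨hE, hp, hq, hc, hr⟩ := hφ xy h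
    exact ⟨hE, by omega, hp, hq, hc⟩
  have hfin : (Diagram w).Finite :=
    ((Set.finite_Iic n).prod (Set.finite_Iic n)).subset fun xy h => ⟨h.2.1, h.2.2.2.1⟩
  have := hfin.to_subtype
  have hcard : Nat.card (Diagram w) = n * (n - 1) / 2 - ell w := ncard_diagram
  let e : Fin (n * (n - 1) / 2 - ell w) ≃ Diagram w := (Finite.equivFinOfCardEq hcard).symm
  let F : ℕ × ℕ → PolyS n := fun xy =>
    if rk w xy.1 xy.2 = 0 then zvar n xy.1 xy.2 else
      dminor n (Finset.Icc (φ xy).1 ((φ xy).1 + rk w xy.1 xy.2 - 1) ∪ {xy.1 + rk w xy.1 xy.2})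
        ({xy.2 - rk w xy.1 xy.2} ∪ Finset.Icc ((φ xy).2 - rk w xy.1 xy.2 + 1) (φ xy).2)
  refine ⟨fun i => F (e i), ?_⟩
  rw [hmain]
  congr 1
  ext f
  constructor
  · rintro ⟨i, rfl⟩
    rcases Nat.eq_zero_or_pos (rk w (e i : ℕ × ℕ).1 (e i : ℕ × ℕ).2) with h0 | hpos
    · exact .inl ⟨e i, (e i).2, h0, if_pos h0⟩
    · exact .inr ⟨e i, (e i).2, hpos, if_neg hpos.ne'⟩
  · rintro (⟨xy, h, h0, rfl⟩ | ⟨xy, h, hpos, rfl⟩)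
    · exact ⟨e.symm ⟨xy, h⟩, by simp [F, h0]⟩
    · exact ⟨e.symm ⟨xy, h⟩, by simp [F, hpos.ne']⟩
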